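/- arXiv:1505.03388 — 3 statements merged into one kernel-verified Lean document; each statement's English description precedes it below -/
import Mathlib

section
/- Let A, B ⊆ ℝ^d be nonempty compact convex sets. Then the set Σ_{A,B} := {(x − y, ξ) ∈ ℝ^d × S^{d−1} : x ∈ A, y ∈ B, ξ ∈ nor(A,x) ∩ nor(B,y)}, regarded as a subset of ℝ^d × ℝ^d = ℝ^{2d}, has finite (d−1)-dimensional upper Minkowski content. -/
open MeasureTheory Metric Filter Set Pointwise
open scoped RealInnerProductSpace ENNReal

/-- The `m`-dimensional upper Minkowski content of a subset of `ℝ^D`. -/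
noncomputable def minkContent {D : ℕ} (m : ℝ) (S : Set (EuclideanSpace ℝ (Fin D))) : ℝ≥0∞ :=
  Filter.limsup
    (fun ε : ℝ => ENNReal.ofReal ((2 * ε) ^ (m - (D : ℝ))) * volume (Metric.cthickening ε S))
    (nhdsWithin 0 (Set.Ioi 0))

/-- The set of unit outer normals to `K` at `x`. -/
def nor {d : ℕ} (K : Set (EuclideanSpace ℝ (Fin d))) (x : EuclideanSpace ℝ (Fin d)) :
    Set (EuclideanSpace ℝ (Fin d)) :=
  {u | ‖u‖ = 1 ∧ ∀ y ∈ K, ⟪u, y⟫ ≤ ⟪u, x⟫}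

/-- Concatenation `ℝ^m × ℝ^n → ℝ^(m+n)` (an isometry for the `L²` product structure). -/
noncomputable def appendE {m n : ℕ} (x : EuclideanSpace ℝ (Fin m)) (y : EuclideanSpace ℝ (Fin n)) :
    EuclideanSpace ℝ (Fin (m + n)) :=
  (EuclideanSpace.equiv (Fin (m + n)) ℝ).symm
    (Fin.append (EuclideanSpace.equiv (Fin m) ℝ x) (EuclideanSpace.equiv (Fin n) ℝ y))

/-- The support function of `K`. -/
noncomputable def suppF {d : ℕ} (K : Set (EuclideanSpace ℝ (Fin d)))
    (n : EuclideanSpace ℝ (Fin d)) : ℝ :=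
  sSup ((fun x => ⟪x, n⟫) '' K)

/-- The cap of `K` of direction `n` and width `t`. -/
def cap {d : ℕ} (K : Set (EuclideanSpace ℝ (Fin d))) (n : EuclideanSpace ℝ (Fin d)) (t : ℝ) :
    Set (EuclideanSpace ℝ (Fin d)) :=
  {x ∈ K | suppF K n - t ≤ ⟪x, n⟫}

/-- The width of `K`. -/
noncomputable def bwidth {d : ℕ} (K : Set (EuclideanSpace ℝ (Fin d))) : ℝ :=
  sInf ((fun n => suppF K n + suppF K (-n)) '' {n : EuclideanSpace ℝ (Fin d) | ‖n‖ = 1})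

section Caps

variable {E : Type*} [NormedAddCommGroup E]

/-- The Macbeath region of `K` at `w`, translated to the origin. -/
def macbeath (K : Set E) (w : E) : Set E := {v | w + v ∈ K ∧ w - v ∈ K}

variable {K : Set E} {ξ ξ' g g' : E} {t N : ℝ}

theorem neg_mem_macbeath {w v : E} (hv : v ∈ macbeath K w) : -v ∈ macbeath K w :=
  ⟨by simpa [sub_eq_add_neg] using hv.2, by simpa using hv.1⟩

theorem zero_mem_macbeath {w : E} (hw : w ∈ K) : (0 : E) ∈ macbeath K w := by
  simpa [macbeath] using hw

theorem isClosed_macbeath (hK : IsClosed K) (w : E) : IsClosed (macbeath K w) :=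
  (hK.preimage (by fun_prop : Continuous fun v => w + v)).inter
    (hK.preimage (by fun_prop : Continuous fun v => w - v))

variable [InnerProductSpace ℝ E]

/-- The cap of `K` of direction `ξ` and width `t`, described without the support function. -/
def faceCap (K : Set E) (ξ : E) (t : ℝ) : Set E := {x ∈ K | ∀ y ∈ K, ⟪ξ, y⟫ - t ≤ ⟪ξ, x⟫}

/-- `g` lies in the cap, and the cap is contained in the `N`-fold Macbeath region at `g`. -/
def IsCapCenter (K : Set E) (ξ : E) (t N : ℝ) (g : E) : Prop :=
  g ∈ faceCap K ξ t ∧ ∀ c ∈ faceCap K ξ t, c - g ∈ N • macbeath K g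

theorem convex_macbeath (hK : Convex ℝ K) (w : E) : Convex ℝ (macbeath K w) := by
  intro u hu v hv a b ha hb hab
  obtain rfl : b = 1 - a := by linarith
  constructor
  · convert hK hu.1 hv.1 ha hb hab using 1
    module
  · convert hK hu.2 hv.2 ha hb hab using 1
    module

theorem Convex.add_mem_add_smul {M : Set E} (hM : Convex ℝ M) {r s : ℝ} (hr : 0 ≤ r) (hs : 0 ≤ s)
    {u v : E} (hu : u ∈ r • M) (hv : v ∈ s • M) : u + v ∈ (r + s) • M := by
  rw [hM.add_smul hr hs]
  exact Set.add_mem_add hu hv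

theorem Convex.smul_mem_smul_of_abs_le {M : Set E} (hM : Convex ℝ M) (h0 : (0 : E) ∈ M)
    (hneg : ∀ v ∈ M, -v ∈ M) {r s : ℝ} (hrs : |r| ≤ s) {v : E} (hv : v ∈ M) : r • v ∈ s • M := by
  rcases (abs_nonneg r).trans hrs |>.eq_or_lt with hs | hs
  · have : r = 0 := by rw [← hs] at hrs; simpa using hrs
    exact ⟨0, h0, by simp [this]⟩
  rw [Set.mem_smul_set_iff_inv_smul_mem₀ hs.ne', smul_smul]
  have hq : |s⁻¹ * r| ≤ 1 := by
    rw [abs_mul, abs_of_pos (inv_pos.2 hs), inv_mul_le_iff₀ hs]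
    simpa using hrs
  rcases le_total 0 (s⁻¹ * r) with h | h
  · exact hM.smul_mem_of_zero_mem h0 hv ⟨h, (le_abs_self _).trans hq⟩
  · have := hM.smul_mem_of_zero_mem h0 (hneg v hv) ⟨neg_nonneg.2 h, (neg_le_abs _).trans hq⟩
    simpa using this

theorem smul_macbeath_mem_smul (hK : Convex ℝ K) (hg : g ∈ K) {a r s : ℝ} (ha : 0 ≤ a)
    (hrs : |r| * a ≤ s) {v : E} (hv : v ∈ a • macbeath K g) : r • v ∈ s • macbeath K g := by
  obtain ⟨v, hv, rfl⟩ := hv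
  simp only [smul_smul]
  exact (convex_macbeath hK g).smul_mem_smul_of_abs_le (zero_mem_macbeath hg)
    (fun _ => neg_mem_macbeath) (by rwa [abs_mul, abs_of_nonneg ha]) hv

theorem macbeath_subset_of_mem (hK : Convex ℝ K) {m v : E} (hm : m ∈ macbeath K g)
    (hv : v ∈ macbeath K g) : (1 / 2 : ℝ) • v ∈ macbeath K (g + (1 / 2 : ℝ) • m) := by
  constructor
  · convert hK hm.1 hv.1 (by norm_num : (0 : ℝ) ≤ 1 / 2) (by norm_num : (0 : ℝ) ≤ 1 / 2)
      (by norm_num) using 1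
    module
  · convert hK hm.1 hv.2 (by norm_num : (0 : ℝ) ≤ 1 / 2) (by norm_num : (0 : ℝ) ≤ 1 / 2)
      (by norm_num) using 1
    module

theorem macbeath_add_half_subset (hK : Convex ℝ K) {m v : E} (hm : m ∈ macbeath K g)
    (hv : v ∈ macbeath K (g + (1 / 2 : ℝ) • m)) : (1 / 3 : ℝ) • v ∈ macbeath K g := by
  have hu : g - (1 / 4 : ℝ) • m ∈ K := by
    convert hK hm.1 hm.2 (by norm_num : (0 : ℝ) ≤ 3 / 8) (by norm_num : (0 : ℝ) ≤ 5 / 8)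
      (by norm_num) using 1
    module
  constructor
  · convert hK hv.1 hu (by norm_num : (0 : ℝ) ≤ 1 / 3) (by norm_num : (0 : ℝ) ≤ 2 / 3)
      (by norm_num) using 1
    module
  · convert hK hv.2 hu (by norm_num : (0 : ℝ) ≤ 1 / 3) (by norm_num : (0 : ℝ) ≤ 2 / 3)
      (by norm_num) using 1
    module

theorem macbeath_subset_of_inter (hK : Convex ℝ K) {m m' : E} (hm : m ∈ macbeath K g)
    (hm' : m' ∈ macbeath K g') (h : g + (1 / 2 : ℝ) • m = g' + (1 / 2 : ℝ) • m') :
    macbeath K g ⊆ (6 : ℝ) • macbeath K g' := by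
  intro v hv
  have h1 := macbeath_subset_of_mem hK hm hv
  rw [h] at h1
  have h2 := macbeath_add_half_subset hK hm' h1
  rw [Set.mem_smul_set_iff_inv_smul_mem₀ (by norm_num)]
  convert h2 using 1
  module

theorem neg_le_inner_of_mem_macbeath (hg : g ∈ faceCap K ξ t) {v : E} (hv : v ∈ macbeath K g) :
    -t ≤ ⟪ξ, v⟫ := by
  have := hg.2 _ hv.2
  rw [inner_sub_right] at this
  linarith

theorem IsCapCenter.faceCap_subset (hK : Convex ℝ K) (hN : 0 ≤ N) (hg : IsCapCenter K ξ t N g)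
    (hg' : IsCapCenter K ξ' t N g') {m m' : E} (hm : m ∈ macbeath K g)
    (hm' : m' ∈ macbeath K g') (h : g + (1 / 2 : ℝ) • m = g' + (1 / 2 : ℝ) • m') :
    faceCap K ξ t ⊆ faceCap K ξ' ((6 * N + 5) * t) := by
  intro c hc
  refine ⟨hc.1, fun y hy => ?_⟩
  obtain ⟨v, hv, hvc⟩ := hg.2 c hc
  obtain ⟨v', hv', rfl⟩ := macbeath_subset_of_inter hK hm hm' h hv
  obtain ⟨m₁, hm₁, rfl⟩ := macbeath_subset_of_inter hK hm hm' h hm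
  have e : c = g' + (1 / 2 : ℝ) • m' + (3 : ℝ) • (-m₁) + (6 * N) • v' := by
    have h2 : c = N • (6 : ℝ) • v' + g := by
      rw [← sub_eq_iff_eq_add]; exact hvc.symm
    have h3 : g = g' + (1 / 2 : ℝ) • m' - (1 / 2 : ℝ) • (6 : ℝ) • m₁ := eq_sub_of_add_eq h
    rw [h2, h3]
    module
  have b1 := neg_le_inner_of_mem_macbeath hg'.1 hm'
  have b2 := neg_le_inner_of_mem_macbeath hg'.1 (neg_mem_macbeath hm₁)
  have b3 := neg_le_inner_of_mem_macbeath hg'.1 hv'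
  have b4 := hg'.1.2 y hy
  have b5 := hg'.1.2 _ hg'.1.1
  rw [e]
  simp only [inner_add_right, inner_smul_right]
  have := mul_le_mul_of_nonneg_left b3 (by positivity : 0 ≤ 6 * N)
  linarith

theorem IsCapCenter.sub_mem (hK : Convex ℝ K) (hN : 0 ≤ N) (hg : IsCapCenter K ξ t N g)
    {p : E} (hp : p ∈ faceCap K ξ 0) {c : ℝ} (hc : 1 ≤ c) {x y : E}
    (hx : x ∈ faceCap K ξ (c * t)) (hy : y ∈ faceCap K ξ (c * t)) :
    x - y ∈ (2 * N * c) • macbeath K g := by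
  have hc0 : 0 < c := by linarith
  have key : ∀ x ∈ faceCap K ξ (c * t), p + c⁻¹ • (x - p) ∈ faceCap K ξ t := by
    intro x hx
    refine ⟨hK.add_smul_sub_mem hp.1 hx.1 ⟨by positivity, inv_le_one_of_one_le₀ hc⟩,
      fun y hy => ?_⟩
    have h1 := hp.2 y hy
    have h2 := hx.2 p hp.1
    have h3 : -t ≤ c⁻¹ * (⟪ξ, x⟫ - ⟪ξ, p⟫) := by
      rw [le_inv_mul_iff₀ hc0]
      linarith
    rw [inner_add_right, inner_smul_right, inner_sub_right]
    linarith
  have hM := convex_macbeath hK g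
  have h1 := hg.2 _ (key x hx)
  have h2 := smul_macbeath_mem_smul hK hg.1.1 (r := -1) (s := N) hN (by simp) (hg.2 _ (key y hy))
  have h3 := smul_macbeath_mem_smul hK hg.1.1 (r := c) (s := 2 * N * c) (by positivity)
    (by rw [abs_of_pos hc0]; linarith) (hM.add_mem_add_smul hN hN h1 h2)
  convert h3 using 1
  match_scalars <;> (field_simp; try ring)

theorem sum_mem_card_smul {C : Set E} (hC : Convex ℝ C) (hne : C.Nonempty) {ι : Type*}
    (s : Finset ι) {f : ι → E} (hf : ∀ i, f i ∈ C) : ∑ i ∈ s, f i ∈ (s.card : ℝ) • C := by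
  classical
  induction s using Finset.induction_on with
  | empty => obtain ⟨c, hc⟩ := hne; exact ⟨c, hc, by simp⟩
  | insert a s ha ih =>
    rw [Finset.sum_insert ha, Finset.card_insert_of_notMem ha, add_comm (f a)]
    push_cast
    exact hC.add_mem_add_smul (by positivity) zero_le_one ih ⟨f a, hf a, one_smul ℝ (f a)⟩

theorem exists_forall_sub_smul_mem [FiniteDimensional ℝ E] {C : Set E} (hC : Convex ℝ C)
    (hCc : IsCompact C) (hne : C.Nonempty) (hn : 0 < Module.finrank ℝ E) :
    ∃ g ∈ C, ∀ c ∈ C, g - (Module.finrank ℝ E : ℝ)⁻¹ • (c - g) ∈ C := by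
  classical
  set n := Module.finrank ℝ E with hn_def
  have hn0 : (0 : ℝ) < n := by exact_mod_cast hn
  have hF := Convex.helly_theorem_compact' (𝕜 := ℝ)
    (F := fun x : C => ({((n : ℝ) + 1)⁻¹ • (x : E)} : Set E) + ((n : ℝ) / (n + 1)) • C)
    (fun x => (convex_singleton _).add (hC.smul _))
    (fun x => isCompact_singleton.add (hCc.smul _)) (by
      intro I hI
      obtain ⟨x₀, hx₀⟩ := hne
      have hI' : (I.card : ℝ) ≤ n + 1 := by exact_mod_cast hI
      refine ⟨((n : ℝ) + 1)⁻¹ • (∑ i ∈ I, (i : E) + ((n : ℝ) + 1 - I.card) • x₀), ?_⟩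
      simp only [Set.mem_iInter]
      intro j hj
      have h1 := sum_mem_card_smul hC ⟨x₀, hx₀⟩ (I.erase j) (f := fun i : C => (i : E))
        (fun i => i.2)
      have h2 : ((n : ℝ) + 1 - I.card) • x₀ ∈ ((n : ℝ) + 1 - I.card) • C :=
        Set.smul_mem_smul_set hx₀
      obtain ⟨c, hc, hce⟩ := hC.add_mem_add_smul (by positivity) (by linarith) h1 h2
      have hcard : ((I.erase j).card : ℝ) + ((n : ℝ) + 1 - I.card) = n := by
        have := Finset.card_erase_add_one hj
        have : ((I.erase j).card : ℝ) + 1 = I.card := by exact_mod_cast this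
        linarith
      rw [hcard] at hce
      refine Set.mem_add.2 ⟨_, rfl, ((n : ℝ) / (n + 1)) • c, Set.smul_mem_smul_set hc, ?_⟩
      rw [← Finset.add_sum_erase I _ hj, add_assoc, ← hce, smul_add, smul_smul, div_eq_inv_mul])
  obtain ⟨g, hg⟩ := hF
  simp only [Set.mem_iInter] at hg
  have key : ∀ x ∈ C, ∃ c ∈ C, g = ((n : ℝ) + 1)⁻¹ • x + ((n : ℝ) / (n + 1)) • c := by
    intro x hx
    obtain ⟨_, rfl, _, ⟨c, hc, rfl⟩, h⟩ := Set.mem_add.1 (hg ⟨x, hx⟩)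
    exact ⟨c, hc, h.symm⟩
  refine ⟨g, ?_, fun x hx => ?_⟩
  · obtain ⟨x₀, hx₀⟩ := hne
    obtain ⟨c, hc, rfl⟩ := key x₀ hx₀
    exact hC hx₀ hc (by positivity) (by positivity) (by field_simp; ring)
  · obtain ⟨c, hc, rfl⟩ := key x hx
    convert hc using 1
    match_scalars <;> field_simp <;> ring

theorem convex_faceCap (hK : Convex ℝ K) : Convex ℝ (faceCap K ξ t) := by
  intro x hx y hy a b ha hb hab
  refine ⟨hK hx.1 hy.1 ha hb hab, fun z hz => ?_⟩
  rw [inner_add_right, inner_smul_right, inner_smul_right]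
  have h1 := mul_le_mul_of_nonneg_left (hx.2 z hz) ha
  have h2 := mul_le_mul_of_nonneg_left (hy.2 z hz) hb
  obtain rfl : b = 1 - a := by linarith
  linarith

theorem isCompact_faceCap (hK : IsCompact K) : IsCompact (faceCap K ξ t) := by
  have : faceCap K ξ t = K ∩ ⋂ y ∈ K, {x | ⟪ξ, y⟫ - t ≤ ⟪ξ, x⟫} := by
    ext x; simp [faceCap]
  rw [this]
  exact hK.inter_right (isClosed_biInter fun y _ => isClosed_le (by fun_prop) (by fun_prop))

theorem exists_mem_faceCap_zero (hK : IsCompact K) (hne : K.Nonempty) (ξ : E) :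
    (faceCap K ξ 0).Nonempty := by
  obtain ⟨x, hx, hmax⟩ := hK.exists_isMaxOn hne (f := fun x => ⟪ξ, x⟫) (by fun_prop)
  exact ⟨x, hx, fun y hy => by simpa using hmax hy⟩

theorem faceCap_mono {t' : ℝ} (h : t ≤ t') : faceCap K ξ t ⊆ faceCap K ξ t' :=
  fun _ hx => ⟨hx.1, fun y hy => by linarith [hx.2 y hy]⟩

theorem exists_isCapCenter [FiniteDimensional ℝ E] (hK : Convex ℝ K) (hKc : IsCompact K)
    (hne : K.Nonempty) (hn : 0 < Module.finrank ℝ E) (ξ : E) (ht : 0 ≤ t) :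
    ∃ g, IsCapCenter K ξ t (Module.finrank ℝ E) g := by
  have hn0 : (1 : ℝ) ≤ Module.finrank ℝ E := by exact_mod_cast hn
  obtain ⟨g, hg, h⟩ := exists_forall_sub_smul_mem (convex_faceCap hK (ξ := ξ) (t := t))
    (isCompact_faceCap hKc) ((exists_mem_faceCap_zero hKc hne ξ).mono (faceCap_mono ht)) hn
  refine ⟨g, hg, fun c hc => ?_⟩
  rw [Set.mem_smul_set_iff_inv_smul_mem₀ (by positivity)]
  exact ⟨hK.add_smul_sub_mem hg.1 hc.1 ⟨by positivity, inv_le_one_of_one_le₀ hn0⟩, (h c hc).1⟩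

section SumWithBall

variable {A B : Set E} {x₀ y₀ : E} {ε : ℝ}

theorem mem_faceCap_add_ball (hx₀ : x₀ ∈ faceCap A ξ 0) (hy₀ : y₀ ∈ faceCap B ξ 0)
    (hξ : ‖ξ‖ = 1) {x y u : E} {r s t' : ℝ} (hx : x ∈ A) (hxr : ⟪ξ, x₀⟫ - r ≤ ⟪ξ, x⟫) (hy : y ∈ B)
    (hys : ⟪ξ, y₀⟫ - s ≤ ⟪ξ, y⟫) (hu : ‖u‖ ≤ 1) (hut : 1 - t' ≤ ⟪ξ, u⟫) :
    x + y + u ∈ faceCap (A + B + closedBall (0 : E) 1) ξ (r + s + t') := by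
  refine ⟨Set.add_mem_add (Set.add_mem_add hx hy) (by simpa using hu), ?_⟩
  rintro _ ⟨_, ⟨a, ha, b, hb, rfl⟩, v, hv, rfl⟩
  have h1 := hx₀.2 a ha
  have h2 := hy₀.2 b hb
  have h3 : ⟪ξ, v⟫ ≤ 1 := by
    have := real_inner_le_norm ξ v
    rw [mem_closedBall_zero_iff] at hv
    rw [hξ] at this
    linarith
  simp only [inner_add_right]
  linarith

theorem le_inner_of_mem_faceCap_add_ball (hx₀ : x₀ ∈ faceCap A ξ 0) (hy₀ : y₀ ∈ faceCap B ξ 0)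
    (hξ : ‖ξ‖ = 1) {x y u : E} (hx : x ∈ A) (hy : y ∈ B) (hu : ‖u‖ ≤ 1)
    (h : x + y + u ∈ faceCap (A + B + closedBall (0 : E) 1) ξ t) :
    ⟪ξ, x₀⟫ - t ≤ ⟪ξ, x⟫ ∧ ⟪ξ, y₀⟫ - t ≤ ⟪ξ, y⟫ ∧ 1 - t ≤ ⟪ξ, u⟫ := by
  have h1 := hx₀.2 x hx
  have h2 := hy₀.2 y hy
  have h3 : ⟪ξ, u⟫ ≤ 1 := by
    have := real_inner_le_norm ξ u
    rw [hξ] at this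
    linarith
  have h4 := h.2 (x₀ + y₀ + ξ)
    (Set.add_mem_add (Set.add_mem_add hx₀.1 hy₀.1) (by simp [hξ]))
  simp only [inner_add_right, real_inner_self_eq_norm_sq, hξ] at h4
  refine ⟨?_, ?_, ?_⟩ <;> linarith

theorem IsCapCenter.smul_normal_mem (hA : Convex ℝ A) (hB : Convex ℝ B)
    (hx₀ : x₀ ∈ faceCap A ξ 0) (hy₀ : y₀ ∈ faceCap B ξ 0) (hξ : ‖ξ‖ = 1) (ht : 0 ≤ t) (ht1 : t ≤ 1)
    (hN : 0 ≤ N) (hg : IsCapCenter (A + B + closedBall (0 : E) 1) ξ t N g) :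
    t • ξ ∈ (2 * N) • macbeath (A + B + closedBall (0 : E) 1) g := by
  have hK := (hA.add hB).add (convex_closedBall (0 : E) 1)
  have h1 := mem_faceCap_add_ball (r := 0) (s := 0) (t' := 0) hx₀ hy₀ hξ hx₀.1 (by simp) hy₀.1
    (by simp) hξ.le (by simp [hξ])
  have h2 := mem_faceCap_add_ball (u := (1 - t) • ξ) (r := 0) (s := 0) (t' := t) hx₀ hy₀ hξ
    hx₀.1 (by simp) hy₀.1 (by simp)
    (by rw [norm_smul, hξ, Real.norm_eq_abs, abs_of_nonneg (by linarith)]; linarith)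
    (by simp [inner_smul_right, hξ])
  simp only [add_zero, zero_add] at h1 h2
  have := hg.sub_mem hK hN h1 le_rfl (faceCap_mono (by linarith) h1) (by simpa using h2)
  rw [mul_one] at this
  convert this using 1
  module

theorem IsCapCenter.orthogonal_mem (hA : Convex ℝ A) (hB : Convex ℝ B)
    (hx₀ : x₀ ∈ faceCap A ξ 0) (hy₀ : y₀ ∈ faceCap B ξ 0) (hξ : ‖ξ‖ = 1) (hε : 0 ≤ ε) (hε1 : ε ≤ 1)
    (hN : 0 ≤ N) (hg : IsCapCenter (A + B + closedBall (0 : E) 1) ξ (ε ^ 2) N g) {v : E}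
    (hv : ‖v‖ ≤ ε) (hvξ : ⟪ξ, v⟫ = 0) :
    v ∈ (2 * N) • macbeath (A + B + closedBall (0 : E) 1) g := by
  have hK := (hA.add hB).add (convex_closedBall (0 : E) 1)
  have ht1 : ε ^ 2 ≤ 1 := pow_le_one₀ hε hε1
  have h1 := mem_faceCap_add_ball (r := 0) (s := 0) (t' := 0) hx₀ hy₀ hξ hx₀.1 (by simp) hy₀.1
    (by simp) hξ.le (by simp [hξ])
  have h2 := mem_faceCap_add_ball (u := (1 - ε ^ 2) • ξ) (r := 0) (s := 0) (t' := ε ^ 2) hx₀ hy₀ hξ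
    hx₀.1 (by simp) hy₀.1 (by simp)
    (by rw [norm_smul, hξ, Real.norm_eq_abs, abs_of_nonneg (by linarith)]; nlinarith)
    (by simp [inner_smul_right, hξ])
  have hnorm : ‖(1 - ε ^ 2) • ξ + v‖ ≤ 1 := by
    rw [← sq_le_one_iff₀ (norm_nonneg _), norm_add_sq_real, inner_smul_left, hvξ, norm_smul, hξ,
      Real.norm_eq_abs, mul_one, sq_abs]
    have := pow_le_pow_left₀ (norm_nonneg v) hv 2
    simp only [mul_zero, add_zero]
    nlinarith [sq_nonneg ε]
  have h3 := mem_faceCap_add_ball (u := (1 - ε ^ 2) • ξ + v) (r := 0) (s := 0) (t' := ε ^ 2)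
    hx₀ hy₀ hξ hx₀.1 (by simp) hy₀.1 (by simp) hnorm
    (by simp [inner_add_right, inner_smul_right, hξ, hvξ])
  simp only [add_zero, zero_add] at h1 h2 h3
  have := hg.sub_mem hK hN h1 le_rfl (by simpa using h3) (by simpa using h2)
  rw [mul_one] at this
  convert this using 1
  module

theorem IsCapCenter.exists_int_sub_mem (hA : Convex ℝ A) (hB : Convex ℝ B)
    (hx₀ : x₀ ∈ faceCap A ξ 0) (hy₀ : y₀ ∈ faceCap B ξ 0) (hξ : ‖ξ‖ = 1) (hε : 0 < ε) (hε1 : ε ≤ 1)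
    (hN : 0 ≤ N) (hg : IsCapCenter (A + B + closedBall (0 : E) 1) ξ (ε ^ 2) N g) {c : ℝ}
    (hc : 1 ≤ c) {x y u e : E} (hx : x ∈ A) (hy : y ∈ B) (hu : ‖u‖ ≤ 1)
    (h : x + y + u ∈ faceCap (A + B + closedBall (0 : E) 1) ξ (c * ε ^ 2)) (he : ‖e‖ ≤ 2 * ε) :
    ∃ j : ℤ, |(j : ℝ)| ≤ 2 / ε + 1 ∧ x - y + e - (x₀ - y₀) - (j * ε ^ 2) • ξ ∈
      (2 * N * c + 6 * N) • macbeath (A + B + closedBall (0 : E) 1) g := by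
  have hK := (hA.add hB).add (convex_closedBall (0 : E) 1)
  have hM := convex_macbeath hK g
  have hε2 : 0 < ε ^ 2 := by positivity
  obtain ⟨b1, b2, -⟩ := le_inner_of_mem_faceCap_add_ball hx₀ hy₀ hξ hx hy hu h
  have h0 := mem_faceCap_add_ball (r := 0) (s := 0) (t' := 0) hx₀ hy₀ hξ hx₀.1 (by simp) hy₀.1
    (by simp) hξ.le (by simp [hξ])
  have h1 := mem_faceCap_add_ball (s := 0) (t' := 0) hx₀ hy₀ hξ hx b1 hy₀.1
    (by simp) hξ.le (by simp [hξ])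
  have h2 := mem_faceCap_add_ball (r := 0) (t' := 0) hx₀ hy₀ hξ hx₀.1 (by simp) hy b2
    hξ.le (by simp [hξ])
  simp only [add_zero, zero_add] at h0 h1 h2
  have hz := hg.sub_mem hK hN h0 hc h1 h2
  set s : ℝ := ⟪ξ, e⟫ with hs
  have hsle : |s| ≤ 2 * ε := by
    have := abs_real_inner_le_norm ξ e
    rw [hξ, one_mul] at this
    exact this.trans he
  set v : E := e - s • ξ with hv
  have hvξ : ⟪ξ, v⟫ = 0 := by simp [hv, inner_sub_right, inner_smul_right, hξ, hs]
  have hvn : ‖v‖ ≤ 2 * ε := by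
    refine le_trans ?_ he
    have : e = v + s • ξ := by simp [hv]
    have h3 : ‖e‖ ^ 2 = ‖v‖ ^ 2 + s ^ 2 := by
      rw [this, norm_add_sq_real, inner_smul_right, real_inner_comm, hvξ, norm_smul, hξ]
      simp
    exact le_of_sq_le_sq (by nlinarith [sq_nonneg s]) (norm_nonneg e)
  have hv2 := hg.orthogonal_mem hA hB hx₀ hy₀ hξ hε.le hε1 hN (v := (1 / 2 : ℝ) • v)
    (by rw [norm_smul]; norm_num; linarith) (by rw [inner_smul_right, hvξ, mul_zero])
  have hv3 := smul_macbeath_mem_smul hK hg.1.1 (r := 2) (s := 4 * N) (by positivity)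
    (by norm_num; linarith) hv2
  have hfr := Int.floor_le (s / ε ^ 2)
  have hfr' := Int.lt_floor_add_one (s / ε ^ 2)
  have hn := smul_macbeath_mem_smul hK hg.1.1 (r := s / ε ^ 2 - ⌊s / ε ^ 2⌋) (s := 2 * N)
    (by positivity) (by rw [abs_of_nonneg (by linarith)]; nlinarith)
    (hg.smul_normal_mem hA hB hx₀ hy₀ hξ hε2.le (pow_le_one₀ hε.le hε1) hN)
  refine ⟨⌊s / ε ^ 2⌋, ?_, ?_⟩
  · have : |s / ε ^ 2| ≤ 2 / ε := by
      rw [abs_div, abs_of_pos hε2, div_le_div_iff₀ hε2 hε]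
      nlinarith
    rw [abs_le] at this ⊢
    constructor <;> linarith
  · have hsum := hM.add_mem_add_smul (by positivity) (by positivity) hz
      (hM.add_mem_add_smul (by positivity) (by positivity) hv3 hn)
    have he2 : 2 * N * c + 6 * N = 2 * N * c + (4 * N + 2 * N) := by ring
    rw [he2]
    convert hsum using 1
    have hsm : (s / ε ^ 2) • ε ^ 2 • ξ = s • ξ := by
      rw [smul_smul, div_mul_cancel₀ _ hε2.ne']
    rw [sub_smul, hsm, hv]
    module

end SumWithBall

theorem vadd_half_macbeath_subset (hK : Convex ℝ K) (hg : g ∈ faceCap K ξ t) (ht : 0 ≤ t) :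
    g +ᵥ (1 / 2 : ℝ) • macbeath K g ⊆ faceCap K ξ (2 * t) := by
  rintro _ ⟨_, ⟨m, hm, rfl⟩, rfl⟩
  refine ⟨?_, fun y hy => ?_⟩
  · convert hK hg.1 hm.1 (by norm_num : (0 : ℝ) ≤ 1 / 2) (by norm_num : (0 : ℝ) ≤ 1 / 2)
      (by norm_num) using 1
    simp only [vadd_eq_add]
    module
  · have h1 := neg_le_inner_of_mem_macbeath hg hm
    have h2 := hg.2 y hy
    simp only [vadd_eq_add, inner_add_right, inner_smul_right]
    linarith

section Volume

variable [FiniteDimensional ℝ E] [MeasurableSpace E] [BorelSpace E] (μ : Measure E)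
  [μ.IsAddHaarMeasure]

open Module (finrank)

/-- The union of all caps of width `2 * t` lies in a thin shell of `K`. -/
theorem measure_setOf_faceCap_le (hK : Convex ℝ K) (hKc : IsCompact K) {k₀ : E}
    (hball : closedBall k₀ 1 ⊆ K) (ht : 0 < t) (ht1 : 3 * t ≤ 1) :
    μ {x | ∃ ξ, ‖ξ‖ = 1 ∧ x ∈ faceCap K ξ (2 * t)} ≤
      ENNReal.ofReal (3 * finrank ℝ E * t) * μ K := by
  set n := finrank ℝ E with hn
  set K' := AffineMap.homothety k₀ (1 - 3 * t) '' K with hK'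
  have hk₀ : k₀ ∈ K := hball (by simp)
  have hsub : K' ⊆ K := by
    rintro _ ⟨x, hx, rfl⟩
    rw [AffineMap.homothety_apply, vsub_eq_sub, vadd_eq_add, add_comm]
    exact hK.add_smul_sub_mem hk₀ hx ⟨by linarith, by linarith⟩
  have hK'c : IsCompact K' := hKc.image (AffineMap.homothety_continuous k₀ _)
  have hincl : {x | ∃ ξ, ‖ξ‖ = 1 ∧ x ∈ faceCap K ξ (2 * t)} ⊆ K \ K' := by
    rintro x ⟨ξ, hξ, hx⟩
    refine ⟨hx.1, ?_⟩
    rintro ⟨z, hz, rfl⟩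
    have h1 := hx.2 z hz
    have h2 := hx.2 (k₀ + ξ) (hball (by simp [hξ]))
    simp only [AffineMap.homothety_apply, vsub_eq_sub, vadd_eq_add, inner_add_right,
      inner_smul_right, inner_sub_right, real_inner_self_eq_norm_sq, hξ] at h1 h2
    nlinarith
  have hfin : μ K ≠ ⊤ := hKc.measure_lt_top.ne
  have hpow : (1 : ℝ) - 3 * n * t ≤ (1 - 3 * t) ^ n := by
    have := one_add_mul_le_pow (a := -(3 * t)) (by linarith) n
    calc (1 : ℝ) - 3 * n * t = 1 + n * -(3 * t) := by ring
      _ ≤ (1 + -(3 * t)) ^ n := this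
      _ = (1 - 3 * t) ^ n := by ring
  have hpos : 0 ≤ (1 - 3 * t) ^ n := pow_nonneg (by linarith) n
  refine (measure_mono hincl).trans ?_
  rw [measure_sdiff hsub hK'c.measurableSet.nullMeasurableSet hK'c.measure_lt_top.ne,
    Measure.addHaar_image_homothety, abs_of_nonneg hpos, tsub_le_iff_right, ← add_mul,
    ← ENNReal.ofReal_add (by positivity) hpos]
  nth_rewrite 1 [← one_mul (μ K)]
  gcongr
  rw [ENNReal.one_le_ofReal]
  linarith

theorem measure_setOf_exists_int_le (M : Set E) (z₀ : E) {R ε : ℝ} (hR : 0 ≤ R)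
    (hε : 0 < ε) (hε1 : ε ≤ 1) :
    μ {z | ∃ j : ℤ, |(j : ℝ)| ≤ 2 / ε + 1 ∧ z - z₀ - (j * ε ^ 2) • ξ ∈ R • M} ≤
      ENNReal.ofReal (7 / ε * R ^ finrank ℝ E) * μ M := by
  set J := ⌊2 / ε + 1⌋ with hJ
  have hJ0 : 0 ≤ J := Int.floor_nonneg.2 (by positivity)
  have hsub : {z | ∃ j : ℤ, |(j : ℝ)| ≤ 2 / ε + 1 ∧ z - z₀ - (j * ε ^ 2) • ξ ∈ R • M} ⊆
      ⋃ j ∈ Finset.Icc (-J) J, (z₀ + ((j : ℝ) * ε ^ 2) • ξ) +ᵥ R • M := by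
    rintro z ⟨j, hj, hz⟩
    simp only [Set.mem_iUnion]
    refine ⟨j, ?_, ⟨_, hz, ?_⟩⟩
    · rw [Finset.mem_Icc, ← abs_le, hJ, Int.le_floor]
      exact_mod_cast hj
    · simp only [vadd_eq_add]
      abel
  refine (measure_mono hsub).trans ((measure_biUnion_finset_le _ _).trans ?_)
  simp only [measure_vadd, Measure.addHaar_smul, abs_of_nonneg (pow_nonneg hR _),
    Finset.sum_const, nsmul_eq_mul, Int.card_Icc]
  rw [ENNReal.ofReal_mul (by positivity), ← mul_assoc]
  gcongr
  rw [← ENNReal.ofReal_natCast]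
  apply ENNReal.ofReal_le_ofReal
  have h1 : (((J + 1 - -J).toNat : ℤ) : ℝ) = 2 * J + 1 := by
    rw [Int.toNat_of_nonneg (by linarith)]
    push_cast
    ring
  have h2 : (J : ℝ) ≤ 2 / ε + 1 := Int.floor_le _
  have h3 : 1 ≤ 1 / ε := by rwa [one_le_div hε]
  calc (((J + 1 - -J).toNat : ℕ) : ℝ) = 2 * J + 1 := by exact_mod_cast h1
    _ ≤ 2 * (2 / ε + 1) + 1 := by linarith
    _ = 4 * (1 / ε) + 3 := by ring
    _ ≤ 7 * (1 / ε) := by linarith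
    _ = 7 / ε := by ring

/-- Pairs `(p, q)` that are `2 * ε`-close to some `(x - y, ξ)`, where `ξ` is a common unit normal
to `A` at `x` and to `B` at `y`. -/
def commonNormalNhd (A B : Set E) (ε : ℝ) : Set (E × E) :=
  {p | ∃ ξ, ‖ξ‖ = 1 ∧ ‖p.2 - ξ‖ ≤ 2 * ε ∧
    ∃ x ∈ faceCap A ξ 0, ∃ y ∈ faceCap B ξ 0, ‖p.1 - (x - y)‖ ≤ 2 * ε}

theorem exists_prod_commonNormalNhd_le {A B : Set E} (hA : A.Nonempty) (hAc : IsCompact A)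
    (hAconv : Convex ℝ A) (hB : B.Nonempty) (hBc : IsCompact B) (hBconv : Convex ℝ B)
    (hn : 0 < finrank ℝ E) :
    ∃ C : ℝ≥0∞, C ≠ ⊤ ∧ ∀ ε : ℝ, 0 < ε → ε ≤ 1 / 2 →
      (μ.prod μ) (commonNormalNhd A B ε) ≤ C * ENNReal.ofReal (ε ^ (finrank ℝ E + 1)) := by
  set n := finrank ℝ E with hn_def
  set N : ℝ := (n : ℝ) with hN_def
  have hN : 0 ≤ N := by positivity
  set c : ℝ := 6 * N + 5 with hc_def
  have hc : 1 ≤ c := by linarith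
  set R : ℝ := 2 * N * c + 6 * N with hR_def
  have hR : 0 ≤ R := by positivity
  set K : Set E := A + B + closedBall (0 : E) 1 with hK_def
  have hK : Convex ℝ K := (hAconv.add hBconv).add (convex_closedBall _ _)
  have hKc : IsCompact K := (hAc.add hBc).add (isCompact_closedBall _ _)
  have hKne : K.Nonempty := (hA.add hB).add ⟨0, by simp⟩
  obtain ⟨a₀, ha₀⟩ := hA
  obtain ⟨b₀, hb₀⟩ := hB
  have hball : closedBall (a₀ + b₀) 1 ⊆ K := by
    intro z hz
    refine Set.mem_add.2 ⟨a₀ + b₀, Set.add_mem_add ha₀ hb₀, z - (a₀ + b₀), ?_, by abel⟩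
    rwa [mem_closedBall_zero_iff, ← dist_eq_norm]
  choose x₀ hx₀ using fun ξ => exists_mem_faceCap_zero hAc ⟨a₀, ha₀⟩ ξ
  choose y₀ hy₀ using fun ξ => exists_mem_faceCap_zero hBc ⟨b₀, hb₀⟩ ξ
  refine ⟨ENNReal.ofReal (7 * R ^ n * 2 ^ n * (2 + 2 * c) ^ n * (3 * N)) * μ (ball 0 1) * μ K,
    ENNReal.mul_ne_top (ENNReal.mul_ne_top ENNReal.ofReal_ne_top measure_ball_lt_top.ne)
      hKc.measure_lt_top.ne, fun ε hε hε2 => ?_⟩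
  have hε1 : ε ≤ 1 := by linarith
  have hεsq : 0 < ε ^ 2 := by positivity
  choose g hg using fun ξ => exists_isCapCenter hK hKc hKne hn ξ hεsq.le
  set M : E → Set E := fun ξ => macbeath K (g ξ) with hM_def
  set cell : E → Set E := fun ξ => g ξ +ᵥ (1 / 2 : ℝ) • M ξ with hcell
  have hMclosed : ∀ ξ, IsClosed (M ξ) := fun ξ => isClosed_macbeath hKc.isClosed _
  have hcell_meas : ∀ ξ, MeasurableSet (cell ξ) := fun ξ =>
    (((hMclosed ξ).smul_of_ne_zero (by norm_num)).vadd _).measurableSet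
  have hμM : ∀ ξ, μ (M ξ) = ENNReal.ofReal (2 ^ n) * μ (cell ξ) := by
    intro ξ
    rw [hcell, measure_vadd, Measure.addHaar_smul, ← mul_assoc, abs_of_nonneg (by positivity),
      ← ENNReal.ofReal_mul (by positivity), ← hn_def, ← mul_pow]
    norm_num
  set Z : E → Set E := fun ξ => {z | ∃ j : ℤ, |(j : ℝ)| ≤ 2 / ε + 1 ∧
    z - (x₀ ξ - y₀ ξ) - (j * ε ^ 2) • ξ ∈ R • M ξ} with hZ_def
  have hZ : ∀ ξ, μ (Z ξ) ≤ ENNReal.ofReal (7 / ε * R ^ n) * μ (M ξ) := fun ξ =>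
    measure_setOf_exists_int_le μ _ _ hR hε hε1
  have hZmem : ∀ ξ, ‖ξ‖ = 1 → ∀ x ∈ A, ∀ y ∈ B, ∀ u, ‖u‖ ≤ 1 →
      x + y + u ∈ faceCap K ξ (c * ε ^ 2) → ∀ e, ‖e‖ ≤ 2 * ε → x - y + e ∈ Z ξ :=
    fun ξ hξ x hx y hy u hu h e he => (hg ξ).exists_int_sub_mem hAconv hBconv (hx₀ ξ) (hy₀ ξ) hξ
      hε hε1 hN hc hx hy hu h he
  have hsum_mem : ∀ ξ, ‖ξ‖ = 1 → ∀ x ∈ faceCap A ξ 0, ∀ y ∈ faceCap B ξ 0,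
      x + y + ξ ∈ faceCap K ξ 0 := by
    intro ξ hξ x hx y hy
    have := mem_faceCap_add_ball (r := 0) (s := 0) (t' := 0) hx hy hξ hx.1 (by simp) hy.1
      (by simp) hξ.le (by simp [hξ])
    simpa using this
  have hcell_pos : ∀ ξ, ‖ξ‖ = 1 → 0 < μ (cell ξ) := by
    intro ξ hξ
    refine pos_iff_ne_zero.2 fun h0 => ?_
    have h1 : μ (Z ξ) = 0 := by
      have := hZ ξ
      rw [hμM, h0] at this
      simpa using this
    have h2 : closedBall (x₀ ξ - y₀ ξ) (2 * ε) ⊆ Z ξ := by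
      intro z hz
      have := hZmem ξ hξ _ (hx₀ ξ).1 _ (hy₀ ξ).1 ξ hξ.le
        (faceCap_mono (by positivity) (hsum_mem ξ hξ _ (hx₀ ξ) _ (hy₀ ξ))) (z - (x₀ ξ - y₀ ξ))
        (by rwa [← dist_eq_norm])
      simpa using this
    exact (measure_closedBall_pos μ (x₀ ξ - y₀ ξ) (by positivity : 0 < 2 * ε)).ne'
      (measure_mono_null h2 h1)
  obtain ⟨u, hu, hdisj, hcover⟩ := Vitali.exists_disjoint_subfamily_covering_enlargement cell
    {ξ : E | ‖ξ‖ = 1} (fun _ => 1) 2 one_lt_two (fun _ _ => zero_le_one) 1 (fun _ _ => le_rfl)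
    (fun ξ hξ => nonempty_of_measure_ne_zero (hcell_pos ξ hξ).ne')
  have hu_count : u.Countable := by
    have := Measure.countable_meas_pos_of_disjoint_iUnion (μ := μ) (As := fun ξ : u => cell ξ)
      (fun ξ => hcell_meas ξ) (fun ξ ξ' h => hdisj ξ.2 ξ'.2 (Subtype.coe_ne_coe.2 h))
    have huniv : {ξ : u | 0 < μ (cell ξ)} = Set.univ :=
      Set.eq_univ_of_forall fun ξ => hcell_pos ξ (hu ξ.2)
    rw [huniv, Set.countable_univ_iff] at this
    exact this
  have hsum : ∑' ξ : u, μ (cell ξ) ≤ ENNReal.ofReal (3 * N * ε ^ 2) * μ K := by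
    rw [← measure_biUnion hu_count hdisj fun ξ _ => hcell_meas ξ]
    refine (measure_mono ?_).trans (measure_setOf_faceCap_le μ hK hKc hball hεsq (by nlinarith))
    refine Set.iUnion₂_subset fun ξ hξ z hz => ⟨ξ, hu hξ, ?_⟩
    exact vadd_half_macbeath_subset hK (hg ξ).1 hεsq.le hz
  have hincl : commonNormalNhd A B ε ⊆
      ⋃ ξ ∈ u, Z ξ ×ˢ closedBall ξ ((2 + 2 * c) * ε) := by
    rintro ⟨p, q⟩ ⟨ξ, hξ, hq, x, hx, y, hy, hp⟩
    obtain ⟨b, hb, ⟨w, ⟨_, ⟨m, hm, rfl⟩, h1⟩, ⟨_, ⟨m', hm', rfl⟩, h2⟩⟩, -⟩ := hcover ξ hξ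
    have hb1 : ‖b‖ = 1 := hu hb
    have hmem : x + y + ξ ∈ faceCap K b (c * ε ^ 2) :=
      (hg ξ).faceCap_subset hK hN (hg b) hm hm' (h1.trans h2.symm)
        (faceCap_mono hεsq.le (hsum_mem ξ hξ x hx y hy))
    simp only [Set.mem_iUnion]
    refine ⟨b, hb, ?_, ?_⟩
    · simpa using hZmem b hb1 x hx.1 y hy.1 ξ hξ.le hmem (p - (x - y)) hp
    · have h3 := (le_inner_of_mem_faceCap_add_ball (hx₀ b) (hy₀ b) hb1 hx.1 hy.1 hξ.le hmem).2.2
      have h4 : ‖ξ - b‖ ≤ 2 * c * ε := by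
        refine le_of_sq_le_sq ?_ (by positivity)
        rw [norm_sub_sq_real, hξ, hb1, real_inner_comm]
        nlinarith [mul_le_mul_of_nonneg_right hc hεsq.le]
      rw [mem_closedBall, dist_eq_norm]
      calc ‖q - b‖ ≤ ‖q - ξ‖ + ‖ξ - b‖ := norm_sub_le_norm_sub_add_norm_sub _ _ _
        _ ≤ (2 + 2 * c) * ε := by linarith
  calc (μ.prod μ) (commonNormalNhd A B ε)
      ≤ ∑' ξ : u, (μ.prod μ) (Z ξ ×ˢ closedBall (ξ : E) ((2 + 2 * c) * ε)) :=
        (measure_mono hincl).trans (measure_biUnion_le _ hu_count _)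
    _ ≤ ∑' ξ : u, ENNReal.ofReal (7 / ε * R ^ n * 2 ^ n * ((2 + 2 * c) * ε) ^ n) * μ (ball 0 1) *
          μ (cell ξ) := by
        refine ENNReal.tsum_le_tsum fun ξ => ?_
        rw [Measure.prod_prod, Measure.addHaar_closedBall _ _ (by positivity), ← hn_def]
        refine (mul_le_mul_left (hZ ξ) _).trans_eq ?_
        rw [hμM, ENNReal.ofReal_mul (q := ((2 + 2 * c) * ε) ^ n) (by positivity),
          ENNReal.ofReal_mul (q := 2 ^ n) (by positivity)]
        ring
    _ ≤ ENNReal.ofReal (7 / ε * R ^ n * 2 ^ n * ((2 + 2 * c) * ε) ^ n) * μ (ball 0 1) *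
          (ENNReal.ofReal (3 * N * ε ^ 2) * μ K) := by
        rw [ENNReal.tsum_mul_left]
        gcongr
    _ = ENNReal.ofReal (7 / ε * R ^ n * 2 ^ n * ((2 + 2 * c) * ε) ^ n * (3 * N * ε ^ 2)) *
          μ (ball 0 1) * μ K := by
        rw [ENNReal.ofReal_mul (q := 3 * N * ε ^ 2) (by positivity)]
        ring
    _ = _ := by
        have : 7 / ε * R ^ n * 2 ^ n * ((2 + 2 * c) * ε) ^ n * (3 * N * ε ^ 2) =
            7 * R ^ n * 2 ^ n * (2 + 2 * c) ^ n * (3 * N) * ε ^ (n + 1) := by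
          rw [mul_pow]
          field_simp
          ring
        rw [this, ENNReal.ofReal_mul (q := ε ^ (n + 1)) (by positivity)]
        ring

end Volume

end Caps


theorem finAddEquivProd_appendE {m n : ℕ} (x : EuclideanSpace ℝ (Fin m))
    (y : EuclideanSpace ℝ (Fin n)) :
    EuclideanSpace.finAddEquivProd (𝕜 := ℝ) (appendE x y) = (x, y) := by
  ext i <;> simp [appendE, EuclideanSpace.equiv]

theorem norm_finAddEquivProd_le {m n : ℕ} (q : EuclideanSpace ℝ (Fin (m + n))) :
    ‖EuclideanSpace.finAddEquivProd (𝕜 := ℝ) q‖ ≤ ‖q‖ := by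
  rw [Prod.norm_def, max_le_iff]
  have h : ‖q‖ ^ 2 = ‖(EuclideanSpace.finAddEquivProd (𝕜 := ℝ) q).1‖ ^ 2 +
      ‖(EuclideanSpace.finAddEquivProd (𝕜 := ℝ) q).2‖ ^ 2 := by
    simp only [EuclideanSpace.norm_sq_eq, Fin.sum_univ_add]
    simp
  constructor <;> refine le_of_sq_le_sq ?_ (norm_nonneg _) <;> rw [h] <;> simp

theorem exists_volume_preimage_finAddEquivProd (m n : ℕ) :
    ∃ c : ℝ≥0∞, c ≠ ⊤ ∧ ∀ s : Set (EuclideanSpace ℝ (Fin m) × EuclideanSpace ℝ (Fin n)),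
      volume (EuclideanSpace.finAddEquivProd (𝕜 := ℝ) ⁻¹' s) = c * (volume.prod volume) s := by
  set L := EuclideanSpace.finAddEquivProd (𝕜 := ℝ) (n := m) (m := n)
  have : (Measure.map L volume).IsAddHaarMeasure := L.isAddHaarMeasure_map volume
  obtain ⟨c, hc⟩ : ∃ c : NNReal, Measure.map L volume = c •
      (volume : Measure (EuclideanSpace ℝ (Fin m))).prod
        (volume : Measure (EuclideanSpace ℝ (Fin n))) :=
    ⟨_, Measure.isAddLeftInvariant_eq_smul _ _⟩
  refine ⟨c, ENNReal.coe_ne_top, fun s => ?_⟩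
  calc volume (L ⁻¹' s) = Measure.map L volume s :=
        (L.toHomeomorph.toMeasurableEquiv.map_apply (μ := volume) s).symm
    _ = c * (volume.prod volume) s := by rw [hc]; rfl

theorem cthickening_subset_preimage_commonNormalNhd {d : ℕ} {A B : Set (EuclideanSpace ℝ (Fin d))}
    {ε : ℝ} (hε : 0 < ε) :
    cthickening ε {q : EuclideanSpace ℝ (Fin (d + d)) |
        ∃ x ∈ A, ∃ y ∈ B, ∃ ξ, ξ ∈ nor A x ∧ ξ ∈ nor B y ∧ q = appendE (x - y) ξ} ⊆
      EuclideanSpace.finAddEquivProd (𝕜 := ℝ) ⁻¹' commonNormalNhd A B ε := by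
  intro q hq
  obtain ⟨_, ⟨x, hx, y, hy, ξ, hξA, hξB, rfl⟩, hdist⟩ := mem_thickening_iff.1
    (cthickening_subset_thickening' (by positivity : 0 < 2 * ε) (by linarith) _ hq)
  have h := (norm_finAddEquivProd_le (q - appendE (x - y) ξ)).trans
    ((dist_eq_norm q _).symm.trans_lt hdist).le
  rw [map_sub, finAddEquivProd_appendE] at h
  exact ⟨ξ, hξA.1, (norm_snd_le _).trans h, x, ⟨hx, by simpa using hξA.2⟩, y,
    ⟨hy, by simpa using hξB.2⟩, (norm_fst_le _).trans h⟩

/-- For nonempty compact convex `A, B ⊆ ℝ^d`, the set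
`Σ_{A,B} = {(x - y, ξ) : x ∈ A, y ∈ B, ξ ∈ nor(A,x) ∩ nor(B,y)}`, viewed in `ℝ^{2d}`, has finite
`(d-1)`-dimensional upper Minkowski content. -/
theorem statement1 {d : ℕ} (A B : Set (EuclideanSpace ℝ (Fin d)))
    (hA : A.Nonempty) (hAc : IsCompact A) (hAconv : Convex ℝ A)
    (hB : B.Nonempty) (hBc : IsCompact B) (hBconv : Convex ℝ B) :
    minkContent ((d : ℝ) - 1)
      {q : EuclideanSpace ℝ (Fin (d + d)) |
        ∃ x ∈ A, ∃ y ∈ B, ∃ ξ, ξ ∈ nor A x ∧ ξ ∈ nor B y ∧ q = appendE (x - y) ξ} < ⊤ := by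
  rcases Nat.eq_zero_or_pos d with rfl | hd
  · have : {q : EuclideanSpace ℝ (Fin (0 + 0)) |
        ∃ x ∈ A, ∃ y ∈ B, ∃ ξ, ξ ∈ nor A x ∧ ξ ∈ nor B y ∧ q = appendE (x - y) ξ} = ∅ := by
      refine Set.eq_empty_of_forall_notMem ?_
      rintro _ ⟨_, _, _, _, ξ, hξ, -⟩
      simpa [Subsingleton.elim ξ 0] using hξ.1
    simp [minkContent, this]
  have hfin : Module.finrank ℝ (EuclideanSpace ℝ (Fin d)) = d := finrank_euclideanSpace_fin
  obtain ⟨C, hC, hbound⟩ := exists_prod_commonNormalNhd_le volume hA hAc hAconv hB hBc hBconv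
    (hfin.symm ▸ hd)
  obtain ⟨c, hc, hvol⟩ := exists_volume_preimage_finAddEquivProd d d
  refine lt_of_le_of_lt (b := c * C) ?_ (ENNReal.mul_lt_top hc.lt_top hC.lt_top)
  refine limsup_le_of_le (by isBoundedDefault) ?_
  filter_upwards [Ioc_mem_nhdsGT (by norm_num : (0 : ℝ) < 1 / 2)] with ε ⟨hε, hε2⟩
  have hpow : (2 * ε) ^ ((d : ℝ) - 1 - ((d + d : ℕ) : ℝ)) * ε ^ (d + 1) ≤ 1 := by
    have h1 : (d : ℝ) - 1 - ((d + d : ℕ) : ℝ) = -((d + 1 : ℕ) : ℝ) := by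
      push_cast
      ring
    rw [h1, Real.rpow_neg (by positivity), Real.rpow_natCast, inv_mul_le_one₀ (by positivity)]
    gcongr
    linarith
  have hmeas := (measure_mono
    (cthickening_subset_preimage_commonNormalNhd (A := A) (B := B) hε)).trans
      ((hvol _).le.trans (mul_le_mul_right (hbound ε hε hε2) c))
  rw [hfin] at hmeas
  refine (mul_le_mul_right hmeas _).trans ?_
  calc ENNReal.ofReal ((2 * ε) ^ ((d : ℝ) - 1 - ((d + d : ℕ) : ℝ))) *
        (c * (C * ENNReal.ofReal (ε ^ (d + 1))))
      = c * C * ENNReal.ofReal ((2 * ε) ^ ((d : ℝ) - 1 - ((d + d : ℕ) : ℝ)) * ε ^ (d + 1)) := by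
        rw [ENNReal.ofReal_mul (by positivity)]
        ring
    _ ≤ c * C * 1 := by
        gcongr
        exact ENNReal.ofReal_le_one.2 hpow
    _ = c * C := mul_one _
end

section
/- Let S ⊆ ℝ^{D₁} have finite m-dimensional upper Minkowski content and let T ⊆ ℝ^{D₂} have finite n-dimensional upper Minkowski content (m, n ≥ 0). Then the Cartesian product S × T ⊆ ℝ^{D₁+D₂} has finite (m+n)-dimensional upper Minkowski content. -/
open MeasureTheory Metric Filter Set Pointwise
open scoped RealInnerProductSpace ENNReal

/-- The projection of `ℝ^(m+n)` onto its first `m` coordinates. -/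
noncomputable def fstE {m n : ℕ} (q : EuclideanSpace ℝ (Fin (m + n))) :
    EuclideanSpace ℝ (Fin m) :=
  WithLp.toLp 2 fun i => q (Fin.castAdd n i)

/-- The projection of `ℝ^(m+n)` onto its last `n` coordinates. -/
noncomputable def sndE {m n : ℕ} (q : EuclideanSpace ℝ (Fin (m + n))) :
    EuclideanSpace ℝ (Fin n) :=
  WithLp.toLp 2 fun j => q (Fin.natAdd m j)

lemma fstE_appendE {m n : ℕ} (x : EuclideanSpace ℝ (Fin m)) (y : EuclideanSpace ℝ (Fin n)) :
    fstE (appendE x y) = x := by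
  ext i
  simp [fstE, appendE]

lemma sndE_appendE {m n : ℕ} (x : EuclideanSpace ℝ (Fin m)) (y : EuclideanSpace ℝ (Fin n)) :
    sndE (appendE x y) = y := by
  ext i
  simp [sndE, appendE]

lemma lipschitzWith_fstE {m n : ℕ} :
    LipschitzWith 1 (fstE : EuclideanSpace ℝ (Fin (m + n)) → EuclideanSpace ℝ (Fin m)) :=
  LipschitzWith.of_dist_le_mul fun p q => by
    rw [NNReal.coe_one, one_mul, EuclideanSpace.dist_eq, EuclideanSpace.dist_eq, Fin.sum_univ_add]
    exact Real.sqrt_le_sqrt (le_add_of_nonneg_right (Finset.sum_nonneg fun _ _ => sq_nonneg _))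

lemma lipschitzWith_sndE {m n : ℕ} :
    LipschitzWith 1 (sndE : EuclideanSpace ℝ (Fin (m + n)) → EuclideanSpace ℝ (Fin n)) :=
  LipschitzWith.of_dist_le_mul fun p q => by
    rw [NNReal.coe_one, one_mul, EuclideanSpace.dist_eq, EuclideanSpace.dist_eq, Fin.sum_univ_add]
    exact Real.sqrt_le_sqrt (le_add_of_nonneg_left (Finset.sum_nonneg fun _ _ => sq_nonneg _))

/-- A `1`-Lipschitz map sends closed thickenings into closed thickenings. -/
lemma LipschitzWith.mapsTo_cthickening {X Y : Type*} [PseudoEMetricSpace X] [PseudoEMetricSpace Y]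
    {f : X → Y} (hf : LipschitzWith 1 f) {A : Set X} {B : Set Y} (h : MapsTo f A B) (ε : ℝ) :
    MapsTo f (cthickening ε A) (cthickening ε B) := by
  intro x hx
  rw [mem_cthickening_iff] at hx ⊢
  refine le_trans (le_infEDist.2 fun a ha => ?_) hx
  exact (infEDist_le_edist_of_mem (h ha)).trans (by simpa using hf x a)

lemma measurePreserving_fstE_sndE (m n : ℕ) :
    MeasurePreserving (fun q : EuclideanSpace ℝ (Fin (m + n)) => (fstE q, sndE q)) := by
  have h := (((PiLp.volume_preserving_toLp (Fin m)).prod (PiLp.volume_preserving_toLp (Fin n))).comp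
    (volume_measurePreserving_sumPiEquivProdPi fun _ : Fin m ⊕ Fin n => ℝ)).comp
    ((volume_measurePreserving_piCongrLeft (fun _ : Fin (m + n) => ℝ) finSumFinEquiv).symm.comp
      (PiLp.volume_preserving_ofLp (Fin (m + n))))
  exact h

/-- The volume of a thickening of a product is at most the product of the volumes of the
thickenings of the factors. -/
lemma volume_cthickening_prod_le {D₁ D₂ : ℕ} (S : Set (EuclideanSpace ℝ (Fin D₁)))
    (T : Set (EuclideanSpace ℝ (Fin D₂))) (ε : ℝ) :
    volume (cthickening ε
      {q : EuclideanSpace ℝ (Fin (D₁ + D₂)) | ∃ x ∈ S, ∃ y ∈ T, q = appendE x y}) ≤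
      volume (cthickening ε S) * volume (cthickening ε T) := by
  rw [← Measure.prod_prod, ← Measure.volume_eq_prod,
    ← (measurePreserving_fstE_sndE D₁ D₂).measure_preimage
      (isClosed_cthickening.prod isClosed_cthickening).measurableSet.nullMeasurableSet]
  refine measure_mono fun q hq => ⟨?_, ?_⟩
  · refine lipschitzWith_fstE.mapsTo_cthickening ?_ ε hq
    rintro _ ⟨x, hx, y, -, rfl⟩
    rwa [fstE_appendE]
  · refine lipschitzWith_sndE.mapsTo_cthickening ?_ ε hq
    rintro _ ⟨x, -, y, hy, rfl⟩
    rwa [sndE_appendE]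

/-- If `S ⊆ ℝ^{D₁}` has finite `m`-content and `T ⊆ ℝ^{D₂}` has finite `n`-content, then the
Cartesian product `S × T ⊆ ℝ^{D₁+D₂}` has finite `(m+n)`-content. -/
theorem statement8 {D₁ D₂ : ℕ} (m n : ℝ) (hm : 0 ≤ m) (hn : 0 ≤ n)
    (S : Set (EuclideanSpace ℝ (Fin D₁))) (T : Set (EuclideanSpace ℝ (Fin D₂)))
    (hS : minkContent m S < ⊤) (hT : minkContent n T < ⊤) :
    minkContent (m + n)
      {q : EuclideanSpace ℝ (Fin (D₁ + D₂)) | ∃ x ∈ S, ∃ y ∈ T, q = appendE x y} < ⊤ := by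
  refine lt_of_le_of_lt ?_ (ENNReal.mul_lt_top hS hT)
  refine le_trans ?_ (ENNReal.limsup_mul_le' (Or.inr hT.ne) (Or.inl hS.ne))
  refine limsup_le_limsup ?_
  filter_upwards [self_mem_nhdsWithin] with ε hε
  have hε' : 0 < 2 * ε := mul_pos two_pos hε
  calc _ ≤ ENNReal.ofReal ((2 * ε) ^ (m + n - ((D₁ + D₂ : ℕ) : ℝ))) *
        (volume (cthickening ε S) * volume (cthickening ε T)) := by
        gcongr
        exact volume_cthickening_prod_le S T ε
    _ = _ := by
        rw [show m + n - ((D₁ + D₂ : ℕ) : ℝ) = (m - D₁) + (n - D₂) by push_cast; ring,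
          Real.rpow_add hε', ENNReal.ofReal_mul (by positivity)]
        exact mul_mul_mul_comm _ _ _ _
end

section
/- Let L ⊆ ℝ^d be a convex body, K := L + B̄(0,2), n ∈ S^{d−1}, and 0 < t ≤ 1/2. Then width C(K,n,t) = t. -/
open MeasureTheory Metric Filter Set Pointwise
open scoped RealInnerProductSpace ENNReal

section SupportFunction

variable {d : ℕ} {K : Set (EuclideanSpace ℝ (Fin d))}

lemma suppF_le (hK : K.Nonempty) {u : EuclideanSpace ℝ (Fin d)} {a : ℝ}
    (h : ∀ x ∈ K, ⟪x, u⟫ ≤ a) : suppF K u ≤ a :=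
  csSup_le (hK.image _) (by rintro _ ⟨x, hx, rfl⟩; exact h x hx)

lemma inner_le_suppF (hK : Bornology.IsBounded K) {x : EuclideanSpace ℝ (Fin d)} (hx : x ∈ K)
    (u : EuclideanSpace ℝ (Fin d)) : ⟪x, u⟫ ≤ suppF K u := by
  obtain ⟨R, hR⟩ := hK.exists_norm_le
  refine le_csSup ⟨R * ‖u‖, ?_⟩ ⟨x, hx, rfl⟩
  rintro _ ⟨y, hy, rfl⟩
  exact (real_inner_le_norm y u).trans (by gcongr; exact hR y hy)

/-- A bounded set containing a closed ball of radius `r` extends at least `2 * r` in each direction. -/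
lemma two_mul_le_suppF_add_suppF_neg (hK : Bornology.IsBounded K)
    {c : EuclideanSpace ℝ (Fin d)} {r : ℝ} (hr : 0 ≤ r) (hc : closedBall c r ⊆ K)
    {u : EuclideanSpace ℝ (Fin d)} (hu : ‖u‖ = 1) : 2 * r ≤ suppF K u + suppF K (-u) := by
  have h₁ := inner_le_suppF hK (x := c + r • u)
    (hc (by simp [norm_smul, hu, abs_of_nonneg hr])) u
  have h₂ := inner_le_suppF hK (x := c - r • u)
    (hc (by simp [norm_smul, hu, abs_of_nonneg hr])) (-u)
  have huu : ⟪u, u⟫ = 1 := by rw [real_inner_self_eq_norm_sq, hu, one_pow]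
  simp only [inner_add_left, inner_sub_left, inner_neg_right, real_inner_smul_left, huu] at h₁ h₂
  linarith

/-- The cap of direction `n` and width `t` extends at most `t` in direction `n`. -/
lemma suppF_cap_add_suppF_cap_neg_le (hK : Bornology.IsBounded K)
    {n : EuclideanSpace ℝ (Fin d)} {t : ℝ} (hcap : (cap K n t).Nonempty) :
    suppF (cap K n t) n + suppF (cap K n t) (-n) ≤ t := by
  have h₁ : suppF (cap K n t) n ≤ suppF K n :=
    suppF_le hcap fun x hx => inner_le_suppF hK hx.1 n
  have h₂ : suppF (cap K n t) (-n) ≤ t - suppF K n :=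
    suppF_le hcap fun x hx => by rw [inner_neg_right]; linarith [hx.2]
  linarith

lemma suppF_add_closedBall_le {L : Set (EuclideanSpace ℝ (Fin d))} (hL : L.Nonempty)
    {n : EuclideanSpace ℝ (Fin d)} (hn : ‖n‖ = 1) {R a : ℝ} (hR : 0 ≤ R)
    (h : ∀ x ∈ L, ⟪x, n⟫ ≤ a) : suppF (L + closedBall 0 R) n ≤ a + R := by
  refine suppF_le (hL.add (nonempty_closedBall.2 hR)) ?_
  rintro _ ⟨x, hx, b, hb, rfl⟩
  have hb' := real_inner_le_norm b n
  rw [hn, mul_one] at hb'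
  rw [inner_add_left]
  linarith [h x hx, mem_closedBall_zero_iff.1 hb]

/-- If `p ∈ L` is extremal in direction `n`, then the cap of `L + closedBall 0 R` contains the ball
of diameter `t` inscribed in `closedBall p R` and touching its boundary at `p + R • n`. -/
lemma closedBall_subset_cap_add_closedBall {L : Set (EuclideanSpace ℝ (Fin d))}
    {n p : EuclideanSpace ℝ (Fin d)} (hn : ‖n‖ = 1) (hp : p ∈ L)
    (hmax : ∀ x ∈ L, ⟪x, n⟫ ≤ ⟪p, n⟫) {R t : ℝ} (ht0 : 0 ≤ t) (ht : t ≤ 2 * R) :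
    closedBall (p + (R - t / 2) • n) (t / 2) ⊆ cap (L + closedBall 0 R) n t := by
  intro x hx
  obtain ⟨v, hv, rfl⟩ : ∃ v, ‖v‖ ≤ t / 2 ∧ p + ((R - t / 2) • n + v) = x :=
    ⟨x - (p + (R - t / 2) • n), by rwa [← dist_eq_norm], by abel⟩
  refine ⟨add_mem_add hp (mem_closedBall_zero_iff.2 ((norm_add_le _ _).trans ?_)), ?_⟩
  · rw [norm_smul, hn, Real.norm_of_nonneg (by linarith)]
    linarith
  · have hs := suppF_add_closedBall_le ⟨p, hp⟩ hn (R := R) (by linarith) hmax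
    have hvn := neg_le_of_abs_le (abs_real_inner_le_norm v n)
    have hnn : ⟪n, n⟫ = 1 := by rw [real_inner_self_eq_norm_sq, hn, one_pow]
    rw [hn, mul_one] at hvn
    simp only [inner_add_left, real_inner_smul_left, hnn]
    linarith

end SupportFunction

/-- For a convex body `L ⊆ ℝ^d`, `K = L + B̄(0,2)`, `n ∈ S^{d-1}` and `0 < t ≤ 1/2`:
`width C(K,n,t) = t`. -/
theorem statement15 {d : ℕ} (L : Set (EuclideanSpace ℝ (Fin d)))
    (hL : L.Nonempty) (hLc : IsCompact L) (hLconv : Convex ℝ L)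
    (n : EuclideanSpace ℝ (Fin d)) (hn : ‖n‖ = 1) (t : ℝ) (ht0 : 0 < t) (ht1 : t ≤ 1 / 2) :
    bwidth (cap (L + Metric.closedBall 0 2) n t) = t := by
  obtain ⟨p, hp, hmax⟩ := hLc.exists_isMaxOn hL
    (f := fun x => ⟪x, n⟫) (by fun_prop)
  have hK : Bornology.IsBounded (L + closedBall 0 2) := hLc.isBounded.add isBounded_closedBall
  have hball := closedBall_subset_cap_add_closedBall hn hp (fun x hx => hmax hx)
    (R := 2) ht0.le (by linarith)
  have hcap := (nonempty_closedBall.2 (half_pos ht0).le).mono hball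
  have hlower : ∀ u : EuclideanSpace ℝ (Fin d), ‖u‖ = 1 →
      t ≤ suppF (cap (L + closedBall 0 2) n t) u + suppF (cap (L + closedBall 0 2) n t) (-u) := by
    intro u hu
    have h := two_mul_le_suppF_add_suppF_neg (hK.subset fun x hx => hx.1) (half_pos ht0).le hball hu
    linarith
  refine IsLeast.csInf_eq ⟨⟨n, hn, ?_⟩, ?_⟩
  · exact (suppF_cap_add_suppF_cap_neg_le hK hcap).antisymm (hlower n hn)
  · rintro _ ⟨u, hu, rfl⟩
    exact hlower u hu
end
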